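/- arXiv:2403.14180 — 4 statements merged into one kernel-verified Lean document; each statement's English description precedes it below -/
import Mathlib

section
/- The GLRT statistic Λ = (a†(I + Z P⊥ Z†)^{-1} a)/(a†(I + Z Z†)^{-1} a) satisfies Λ = 1/(1 − Λ'), where Λ' = |a†(I + Z P⊥ Z†)^{-1} z|² / [a†(I + Z P⊥ Z†)^{-1} a · (1 + z†(I + Z P⊥ Z†)^{-1} z)], with z = Z ω*/√(ω^T ω*) and Z Z† = Z P⊥ Z† + z z†. -/
open Matrix
open scoped ComplexOrder

/-- the GLRT statistic `Λ` satisfies `Λ = 1/(1 - Λ')`. -/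
theorem stmt2 {m K : ℕ} (Z : Matrix (Fin m) (Fin K) ℂ) (a : Fin m → ℂ) (ha : a ≠ 0)
    (w : Fin K → ℂ) (hw : w ≠ 0)
    (s : ℂ) (hs : s = w ⬝ᵥ star w)
    (Pperp : Matrix (Fin K) (Fin K) ℂ) (hPp : Pperp = 1 - s⁻¹ • vecMulVec (star w) w)
    (z : Fin m → ℂ) (hz : z = ((Real.sqrt s.re : ℝ) : ℂ)⁻¹ • (Z *ᵥ star w))
    (M : Matrix (Fin m) (Fin m) ℂ) (hM : M = 1 + Z * Pperp * Zᴴ)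
    (Lam : ℂ) (hLam : Lam = (star a ⬝ᵥ (M⁻¹ *ᵥ a)) / (star a ⬝ᵥ ((1 + Z * Zᴴ)⁻¹ *ᵥ a)))
    (Lam' : ℂ)
    (hLam' : Lam' = (star a ⬝ᵥ (M⁻¹ *ᵥ z)) * star (star a ⬝ᵥ (M⁻¹ *ᵥ z)) /
      ((star a ⬝ᵥ (M⁻¹ *ᵥ a)) * (1 + star z ⬝ᵥ (M⁻¹ *ᵥ z)))) :
    Lam = 1 / (1 - Lam') := by
  have hspos : 0 < s := by
    rw [hs, dotProduct_comm]; exact Matrix.dotProduct_star_self_pos_iff.mpr hw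
  have hs0 : s ≠ 0 := hspos.ne'
  obtain ⟨hre, him⟩ := Complex.lt_def.mp hspos
  have hsr : ((s.re : ℝ) : ℂ) = s := by
    apply Complex.ext
    · simp
    · simpa using him
  have hsq : ((Real.sqrt s.re : ℝ) : ℂ) * ((Real.sqrt s.re : ℝ) : ℂ) = s := by
    rw [← Complex.ofReal_mul, Real.mul_self_sqrt (by simpa using hre.le), hsr]
  have hstar : star s = s := by
    rw [← hsr]; simp
  have hPH : Pperpᴴ = Pperp := by
    rw [hPp, conjTranspose_sub, conjTranspose_smul, conjTranspose_vecMulVec, star_inv₀, hstar]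
    simp
  have hPP : Pperp * Pperp = Pperp := by
    have h1 : vecMulVec (star w) w * vecMulVec (star w) w = s • vecMulVec (star w) w := by
      rw [vecMulVec_mul_vecMulVec, ← hs, vecMulVec_smul]
    rw [hPp, sub_mul, mul_sub, mul_sub, smul_mul_smul_comm, h1, smul_smul]
    simp [hs0]
  have hMpd : M.PosDef := by
    have h : M = 1 + (Z * Pperp) * (Z * Pperp)ᴴ := by
      rw [hM, conjTranspose_mul, hPH, Matrix.mul_assoc Z Pperp (Pperp * Zᴴ),
        ← Matrix.mul_assoc Pperp Pperp, hPP, Matrix.mul_assoc]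
    rw [h]
    exact PosDef.one.add_posSemidef (posSemidef_self_mul_conjTranspose _)
  have hNpd : (1 + Z * Zᴴ).PosDef :=
    PosDef.one.add_posSemidef (posSemidef_self_mul_conjTranspose _)
  have hzz : vecMulVec z (star z) = s⁻¹ • (Z * vecMulVec (star w) w * Zᴴ) := by
    rw [hz, star_smul, vecMulVec_smul, smul_vecMulVec, smul_smul, star_mulVec, star_star,
      mul_vecMulVec, vecMulVec_mul]
    congr 1
    rw [← hsq, mul_inv]
    simp
  have hN : 1 + Z * Zᴴ = M + vecMulVec z (star z) := by
    rw [hM, hzz, hPp, Matrix.mul_sub, Matrix.sub_mul]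
    simp only [Matrix.mul_one, Matrix.mul_smul, Matrix.smul_mul]
    abel
  have hMu : IsUnit M.det := (isUnit_iff_isUnit_det _).mp hMpd.isUnit
  have hNu : IsUnit (1 + Z * Zᴴ).det := (isUnit_iff_isUnit_det _).mp hNpd.isUnit
  have hα : star a ⬝ᵥ (M⁻¹ *ᵥ a) ≠ 0 := (hMpd.inv.dotProduct_mulVec_pos ha).ne'
  have hδ : star a ⬝ᵥ ((1 + Z * Zᴴ)⁻¹ *ᵥ a) ≠ 0 := (hNpd.inv.dotProduct_mulVec_pos ha).ne'
  have hγ : 1 + star z ⬝ᵥ (M⁻¹ *ᵥ z) ≠ 0 := by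
    have := hMpd.inv.posSemidef.dotProduct_mulVec_nonneg z
    exact (add_pos_of_pos_of_nonneg one_pos this).ne'
  have hβ : star z ⬝ᵥ (M⁻¹ *ᵥ a) = star (star a ⬝ᵥ (M⁻¹ *ᵥ z)) := by
    rw [← star_dotProduct_star, star_star, star_mulVec, hMpd.inv.isHermitian.eq,
      ← dotProduct_mulVec]
  have hx : (1 + Z * Zᴴ)⁻¹ *ᵥ a = M⁻¹ *ᵥ a -
      ((star z ⬝ᵥ (M⁻¹ *ᵥ a)) / (1 + star z ⬝ᵥ (M⁻¹ *ᵥ z))) • (M⁻¹ *ᵥ z) := by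
    have key : (1 + Z * Zᴴ) *ᵥ (M⁻¹ *ᵥ a -
      ((star z ⬝ᵥ (M⁻¹ *ᵥ a)) / (1 + star z ⬝ᵥ (M⁻¹ *ᵥ z))) • (M⁻¹ *ᵥ z)) = a := by
      have e : ∀ v : Fin m → ℂ, (1 + Z * Zᴴ) *ᵥ (M⁻¹ *ᵥ v) =
          v + (star z ⬝ᵥ (M⁻¹ *ᵥ v)) • z := by
        intro v
        rw [hN, add_mulVec, mulVec_mulVec, mul_nonsing_inv _ hMu, one_mulVec, vecMulVec_mulVec]
        simp
      rw [mulVec_sub, mulVec_smul, e, e]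
      ext i
      simp only [Pi.sub_apply, Pi.add_apply, Pi.smul_apply, smul_eq_mul]
      field_simp
      ring
    conv_lhs => rw [← key]
    rw [mulVec_mulVec, nonsing_inv_mul _ hNu, one_mulVec]
  rw [hx, dotProduct_sub, dotProduct_smul, hβ, smul_eq_mul] at hδ
  rw [hLam, hLam', hx, dotProduct_sub, dotProduct_smul, hβ, smul_eq_mul]
  generalize star a ⬝ᵥ (M⁻¹ *ᵥ a) = α at *
  generalize star a ⬝ᵥ (M⁻¹ *ᵥ z) = β at *
  generalize 1 + star z ⬝ᵥ (M⁻¹ *ᵥ z) = γ at *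
  have h2 : 1 - β * star β / (α * γ) = (α - star β / γ * β) / α := by
    field_simp
  rw [h2, one_div_div]
end

section
/- Determinant factorization: det[I + (Z̃ − ξ ã ω^T)(Z̃ − ξ ã ω^T)†] = det[I + Z̃ P⊥_ω Z̃†] · (1 + (ω^T ω*)(ξ ã − Z̃ω*/(ω^T ω*))† (I + Z̃ P⊥_ω Z̃†)^{-1} (ξ ã − Z̃ω*/(ω^T ω*))). -/
open Matrix
open scoped ComplexOrder

/-- determinant factorization of the rank-one perturbed Gram matrix. -/
theorem stmt6 {m K : ℕ} (Zt : Matrix (Fin m) (Fin K) ℂ) (atil : Fin m → ℂ) (ξ : ℂ)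
    (w : Fin K → ℂ) (hw : w ≠ 0)
    (s : ℂ) (hs : s = w ⬝ᵥ star w)
    (Pperp : Matrix (Fin K) (Fin K) ℂ) (hPp : Pperp = 1 - s⁻¹ • vecMulVec (star w) w)
    (v : Fin m → ℂ) (hv : v = ξ • atil - s⁻¹ • (Zt *ᵥ star w)) :
    det (1 + (Zt - ξ • vecMulVec atil w) * (Zt - ξ • vecMulVec atil w)ᴴ) =
      det (1 + Zt * Pperp * Ztᴴ) *
        (1 + s * (star v ⬝ᵥ ((1 + Zt * Pperp * Ztᴴ)⁻¹ *ᵥ v))) := by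
  have hs0 : s ≠ 0 := by
    rw [hs]
    intro h
    exact hw (dotProduct_star_self_eq_zero.mp ((dotProduct_comm _ _).trans h))
  have hss : star s = s := by
    rw [hs]
    simp [dotProduct, mul_comm]
  have hPH : Pperpᴴ = Pperp := by
    rw [hPp]
    simp only [conjTranspose_sub, conjTranspose_one, conjTranspose_smul, star_inv₀, hss,
      conjTranspose_vecMulVec, star_star]
  have hPP : Pperp * Pperp = Pperp := by
    have h1 : vecMulVec (star w) w * vecMulVec (star w) w = s • vecMulVec (star w) w := by
      rw [vecMulVec_mul_vecMulVec, ← hs]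
      ext i j
      simp [vecMulVec_apply]
      try ring
    rw [hPp]
    simp only [sub_mul, mul_sub, one_mul, mul_one, smul_mul_assoc, mul_smul_comm, h1, smul_smul]
    rw [inv_mul_cancel₀ hs0, one_smul, sub_self, smul_zero, sub_zero]
  have hpd : (1 + Zt * Pperp * Ztᴴ).PosDef := by
    have : Zt * Pperp * Ztᴴ = (Zt * Pperp) * (Zt * Pperp)ᴴ := by
      rw [conjTranspose_mul, hPH, Matrix.mul_assoc Zt Pperp (Pperp * Ztᴴ),
        ← Matrix.mul_assoc Pperp, hPP, Matrix.mul_assoc]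
    rw [this]
    exact PosDef.one.add_posSemidef (posSemidef_self_mul_conjTranspose _)
  have hdet : IsUnit (1 + Zt * Pperp * Ztᴴ).det :=
    (isUnit_iff_isUnit_det _).mp hpd.isUnit
  have key : 1 + (Zt - ξ • vecMulVec atil w) * (Zt - ξ • vecMulVec atil w)ᴴ =
      (1 + Zt * Pperp * Ztᴴ) + replicateCol Unit (s • v) * replicateRow Unit (star v) := by
    have hu : w ᵥ* Ztᴴ = star (Zt *ᵥ star w) := by
      rw [star_mulVec, star_star]
    have hz : (Zt - ξ • vecMulVec atil w) *ᵥ star w = Zt *ᵥ star w - (ξ * s) • atil := by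
      rw [sub_mulVec, smul_mulVec, vecMulVec_mulVec, ← hs]
      ext i
      simp
      ring
    rw [hPp, ← vecMulVec_eq, hv]
    simp only [conjTranspose_sub, conjTranspose_smul, conjTranspose_vecMulVec, Matrix.sub_mul,
      Matrix.mul_sub, Matrix.mul_one, Matrix.smul_mul, Matrix.mul_smul, mul_vecMulVec, vecMulVec_mul, hu, hz]
    ext i j
    simp only [Matrix.add_apply, Matrix.sub_apply, Matrix.smul_apply, vecMulVec_apply,
      Pi.smul_apply, Pi.sub_apply, Pi.star_apply, star_sub, star_smul, smul_eq_mul, star_inv₀, hss]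
    field_simp
    ring
  rw [key, det_add_replicateCol_mul_replicateRow hdet]
  congr 1
  rw [det_unique]
  simp only [Matrix.add_apply, Matrix.one_apply_eq]
  congr 1
  rw [Matrix.mul_assoc, ← replicateCol_mulVec, mulVec_smul]
  simp [Matrix.mul_apply, dotProduct, Finset.mul_sum]
  try (refine Finset.sum_congr rfl fun i _ => ?_; ring)
end

section
/- If A is Hermitian positive definite and a ≠ 0, then det[A − (a a† A^{-1} B)/(a† A^{-1} a)] = det[A] · (a†(stuff)); concretely, det[I + Z̃Z̃† − (ã ã† (I + Z̃P⊥Z̃†)^{-1} Z̃ P_ω Z̃†)/(ã†(I + Z̃P⊥Z̃†)^{-1}ã)] = det[I + Z̃Z̃†] · (ã†(I + Z̃Z̃†)^{-1}ã)/(ã†(I + Z̃P⊥Z̃†)^{-1}ã). -/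
open Matrix
open scoped ComplexOrder

/-- the determinant identity used in the OGLRT derivation. -/
theorem stmt7 {m K : ℕ} (Zt : Matrix (Fin m) (Fin K) ℂ) (atil : Fin m → ℂ) (hatil : atil ≠ 0)
    (w : Fin K → ℂ) (hw : w ≠ 0)
    (s : ℂ) (hs : s = w ⬝ᵥ star w)
    (Pw : Matrix (Fin K) (Fin K) ℂ) (hPw : Pw = s⁻¹ • vecMulVec (star w) w)
    (Pperp : Matrix (Fin K) (Fin K) ℂ) (hPp : Pperp = 1 - Pw)
    (M : Matrix (Fin m) (Fin m) ℂ) (hM : M = 1 + Zt * Pperp * Ztᴴ)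
    (d : ℂ) (hd : d = star atil ⬝ᵥ (M⁻¹ *ᵥ atil)) :
    det (1 + Zt * Ztᴴ - d⁻¹ • (vecMulVec atil (star atil) * M⁻¹ * Zt * Pw * Ztᴴ)) =
      det (1 + Zt * Ztᴴ) * (star atil ⬝ᵥ ((1 + Zt * Ztᴴ)⁻¹ *ᵥ atil)) / d := by
  have hs0 : s ≠ 0 := by
    rw [hs]; intro h; rw [dotProduct_comm] at h; exact hw (dotProduct_star_self_eq_zero.mp h)
  have hss : star s = s := by
    rw [hs]; simp [dotProduct, star_sum, mul_comm]
  have hPH : Pwᴴ = Pw := by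
    rw [hPw, conjTranspose_smul, star_inv₀, hss, conjTranspose_vecMulVec, star_star]
  have hPP : Pw * Pw = Pw := by
    rw [hPw, smul_mul_smul_comm, vecMulVec_mul_vecMulVec, ← hs, vecMulVec_smul, smul_smul]
    congr 1
    field_simp
  have hQ : Pperp.PosSemidef := by
    have : Pperp = Pperpᴴ * Pperp := by
      rw [hPp, conjTranspose_sub, hPH, conjTranspose_one, sub_mul, mul_sub, mul_sub, hPP]; simp
    rw [this]; exact posSemidef_conjTranspose_mul_self _
  have hMpd : M.PosDef := by
    rw [hM]; exact PosDef.one.add_posSemidef (hQ.mul_mul_conjTranspose_same Zt)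
  have hSpd : (1 + Zt * Ztᴴ).PosDef :=
    PosDef.one.add_posSemidef (posSemidef_self_mul_conjTranspose Zt)
  have hd0 : d ≠ 0 := by
    rw [hd]; exact (hMpd.inv.dotProduct_mulVec_pos hatil).ne'
  have hB : Zt * Pw * Ztᴴ = (1 + Zt * Ztᴴ) - M := by
    rw [hM, hPp, Matrix.mul_sub, Matrix.sub_mul, Matrix.mul_one]; abel
  generalize 1 + Zt * Ztᴴ = S at *
  have hSu : IsUnit S.det := hSpd.det_pos.ne'.isUnit
  have hMu : IsUnit M.det := hMpd.det_pos.ne'.isUnit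
  have e1 : S - d⁻¹ • (vecMulVec atil (star atil) * M⁻¹ * Zt * Pw * Ztᴴ)
      = (1 - vecMulVec atil (d⁻¹ • (star atil ᵥ* (M⁻¹ - S⁻¹)))) * S := by
    have h2 : (M⁻¹ - S⁻¹) * S = M⁻¹ * (S - M) := by
      rw [sub_mul, mul_sub, nonsing_inv_mul _ hSu, nonsing_inv_mul _ hMu]
    have h3 : vecMulVec atil (star atil) * M⁻¹ * Zt * Pw * Ztᴴ
        = vecMulVec atil (star atil) * (M⁻¹ * (Zt * Pw * Ztᴴ)) := by
      simp only [Matrix.mul_assoc]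
    rw [h3, hB, ← h2, sub_mul 1, one_mul, vecMulVec_smul, Matrix.smul_mul, ← vecMulVec_mul, Matrix.mul_assoc]
  have e2 : det (1 - vecMulVec atil (d⁻¹ • (star atil ᵥ* (M⁻¹ - S⁻¹))))
      = 1 - (d⁻¹ • (star atil ᵥ* (M⁻¹ - S⁻¹))) ⬝ᵥ atil := by
    rw [sub_eq_add_neg, ← neg_vecMulVec, vecMulVec_eq Unit, det_one_add_replicateCol_mul_replicateRow, dotProduct_neg,
      ← sub_eq_add_neg]
  rw [e1, det_mul, e2, smul_dotProduct, ← dotProduct_mulVec, sub_mulVec, dotProduct_sub, ← hd,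
    smul_eq_mul]
  field_simp
  ring
end

section
/- The Rao statistic decomposition: with Λ' , Λ'' = Λ'/(1−Λ'), and Λ_LHAMF = |ã†M^{-1}z|²/(ã†M^{-1}ã) where M = I + Z̃P⊥Z̃†, the Rao statistic Λ_Rao = |ã†(I+Z̃Z̃†)^{-1}z|²/(ã†(I+Z̃Z̃†)^{-1}ã) satisfies Λ_Rao = Λ'·Λ''/Λ_LHAMF. -/
open Matrix
open scoped ComplexOrder

/-- the Rao statistic decomposes as `Λ_Rao = Λ'·Λ''/Λ_LHAMF`. -/
theorem stmt15 {m K : ℕ} (Zt : Matrix (Fin m) (Fin K) ℂ) (atil : Fin m → ℂ) (hatil : atil ≠ 0)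
    (w : Fin K → ℂ) (hw : w ≠ 0)
    (s : ℂ) (hs : s = w ⬝ᵥ star w)
    (Pperp : Matrix (Fin K) (Fin K) ℂ) (hPp : Pperp = 1 - s⁻¹ • vecMulVec (star w) w)
    (z : Fin m → ℂ) (hz : z = ((Real.sqrt s.re : ℝ) : ℂ)⁻¹ • (Zt *ᵥ star w))
    (M : Matrix (Fin m) (Fin m) ℂ) (hM : M = 1 + Zt * Pperp * Ztᴴ)
    (N : Matrix (Fin m) (Fin m) ℂ) (hN : N = 1 + Zt * Ztᴴ)
    (hnum : star atil ⬝ᵥ (M⁻¹ *ᵥ z) ≠ 0)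
    (Lam' : ℂ)
    (hLam' : Lam' = (star atil ⬝ᵥ (M⁻¹ *ᵥ z)) * star (star atil ⬝ᵥ (M⁻¹ *ᵥ z)) /
      ((star atil ⬝ᵥ (M⁻¹ *ᵥ atil)) * (1 + star z ⬝ᵥ (M⁻¹ *ᵥ z))))
    (Lam'' : ℂ) (hLam'' : Lam'' = Lam' / (1 - Lam'))
    (LamLHAMF : ℂ)
    (hLH : LamLHAMF = (star atil ⬝ᵥ (M⁻¹ *ᵥ z)) * star (star atil ⬝ᵥ (M⁻¹ *ᵥ z)) /
      (star atil ⬝ᵥ (M⁻¹ *ᵥ atil)))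
    (LamRao : ℂ)
    (hRao : LamRao = (star atil ⬝ᵥ (N⁻¹ *ᵥ z)) * star (star atil ⬝ᵥ (N⁻¹ *ᵥ z)) /
      (star atil ⬝ᵥ (N⁻¹ *ᵥ atil))) :
    LamRao = Lam' * Lam'' / LamLHAMF := by
  have hspos : 0 < s := by
    rw [hs, dotProduct_comm]
    have := Matrix.dotProduct_star_self_pos_iff (v := w)
    exact this.2 hw
  obtain ⟨hre, him⟩ := Complex.pos_iff.1 hspos
  have hs0 : s ≠ 0 := hspos.ne'
  have hsr : ((s.re : ℝ) : ℂ) = s := Complex.ext (by simp) (by simp [← him])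
  have hstars : star s = s := by
    rw [← hsr]; exact Complex.conj_ofReal _
  have hPH : Pperpᴴ = Pperp := by
    rw [hPp, conjTranspose_sub, conjTranspose_smul, conjTranspose_vecMulVec, star_star,
      conjTranspose_one, star_inv₀, hstars]
  have hPP : Pperp * Pperp = Pperp := by
    have h1 : vecMulVec (star w) w * vecMulVec (star w) w = s • vecMulVec (star w) w := by
      rw [vecMulVec_mul_vecMulVec, ← hs]
      ext i j
      simp [vecMulVec_apply]
      try ring
    rw [hPp]
    simp only [sub_mul, mul_sub, one_mul, mul_one, smul_mul_assoc, mul_smul_comm, h1, smul_smul]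
    rw [inv_mul_cancel₀ hs0, one_smul, sub_self, smul_zero, sub_zero]
  have hMpd : M.PosDef := by
    have : M = 1 + (Zt * Pperp) * (Zt * Pperp)ᴴ := by
      rw [hM, conjTranspose_mul, hPH, Matrix.mul_assoc, Matrix.mul_assoc, ← Matrix.mul_assoc Pperp,
        hPP]
    rw [this]
    exact Matrix.PosDef.one.add_posSemidef (posSemidef_self_mul_conjTranspose _)
  have hNpd : N.PosDef := by
    rw [hN]
    exact Matrix.PosDef.one.add_posSemidef (posSemidef_self_mul_conjTranspose _)
  have hsz : star z = ((Real.sqrt s.re : ℝ) : ℂ)⁻¹ • (w ᵥ* Ztᴴ) := by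
    rw [hz, star_smul, star_mulVec, star_star, star_inv₀]
    congr 2
    exact Complex.conj_ofReal _
  have hq : ((Real.sqrt s.re : ℝ) : ℂ)⁻¹ * ((Real.sqrt s.re : ℝ) : ℂ)⁻¹ = s⁻¹ := by
    rw [← mul_inv, ← Complex.ofReal_mul, Real.mul_self_sqrt hre.le, hsr]
  have hNM : N = M + vecMulVec z (star z) := by
    rw [hsz]
    conv_rhs => rw [hz]
    rw [smul_vecMulVec, vecMulVec_smul, smul_smul, hq, ← mul_vecMulVec, ← vecMulVec_mul, hM, hN,
      hPp]
    simp only [Matrix.mul_sub, Matrix.sub_mul, Matrix.mul_one, Matrix.mul_smul, Matrix.smul_mul,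
      Matrix.mul_assoc]
    abel
  have hMdet : IsUnit M.det := (Matrix.isUnit_iff_isUnit_det _).1 hMpd.isUnit
  have hNdet : IsUnit N.det := (Matrix.isUnit_iff_isUnit_det _).1 hNpd.isUnit
  have hMi := hMpd.inv
  have hα : 0 < star atil ⬝ᵥ (M⁻¹ *ᵥ atil) := hMi.dotProduct_mulVec_pos hatil
  have hc : 0 ≤ star z ⬝ᵥ (M⁻¹ *ᵥ z) := hMi.posSemidef.dotProduct_mulVec_nonneg z
  have hb : star z ⬝ᵥ (M⁻¹ *ᵥ atil) = star (star atil ⬝ᵥ (M⁻¹ *ᵥ z)) := by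
    rw [star_dotProduct, star_mulVec, hMi.isHermitian.eq, ← dotProduct_mulVec]
  have key : ∀ x : Fin m → ℂ, M⁻¹ *ᵥ x = N⁻¹ *ᵥ x + (star z ⬝ᵥ (M⁻¹ *ᵥ x)) • (N⁻¹ *ᵥ z) := by
    intro x
    have h1 : N *ᵥ (M⁻¹ *ᵥ x) = x + (star z ⬝ᵥ (M⁻¹ *ᵥ x)) • z := by
      conv_lhs => rw [hNM]
      rw [add_mulVec, mulVec_mulVec, Matrix.mul_nonsing_inv _ hMdet, one_mulVec, vecMulVec_mulVec]
      simp
    have h2 := congrArg (fun v => N⁻¹ *ᵥ v) h1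
    simpa [mulVec_mulVec, ← Matrix.mul_assoc, Matrix.nonsing_inv_mul _ hNdet, mulVec_add, mulVec_smul] using h2
  have k1 := congrArg (fun v => star atil ⬝ᵥ v) (key z)
  have k2 := congrArg (fun v => star atil ⬝ᵥ v) (key atil)
  simp only [dotProduct_add, dotProduct_smul, smul_eq_mul, hb] at k1 k2
  have hc1 : 1 + star z ⬝ᵥ (M⁻¹ *ᵥ z) ≠ 0 := (add_pos_of_pos_of_nonneg one_pos hc).ne'
  have hcs : star (1 + star z ⬝ᵥ (M⁻¹ *ᵥ z)) = 1 + star z ⬝ᵥ (M⁻¹ *ᵥ z) :=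
    (IsSelfAdjoint.of_nonneg (add_pos_of_pos_of_nonneg one_pos hc).le).star_eq
  have hα0 := hα.ne'
  subst hLam'' hLam' hLH hRao
  clear key hα
  generalize star atil ⬝ᵥ (M⁻¹ *ᵥ z) = b at *
  generalize star atil ⬝ᵥ (M⁻¹ *ᵥ atil) = α at *
  generalize star z ⬝ᵥ (M⁻¹ *ᵥ z) = c at *
  generalize star atil ⬝ᵥ (N⁻¹ *ᵥ z) = b' at *
  generalize star atil ⬝ᵥ (N⁻¹ *ᵥ atil) = α' at *
  obtain ⟨d, rfl⟩ : ∃ d, c = d - 1 := ⟨1 + c, by ring⟩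
  have hd : 1 + (d - 1) = d := by ring
  rw [hd] at hcs hc1 ⊢
  have e1 : b = b' * d := by rw [k1]; ring
  have e2 : star b = star b' * d := by rw [e1, star_mul, hcs]; ring
  have hb' : b' ≠ 0 := by rintro rfl; simp [e1] at hnum
  have hb2 : star b' ≠ 0 := star_ne_zero.2 hb'
  rw [e2] at k2 ⊢
  have e3 : α - b' * d * star b' = α' := by rw [k2]; ring
  rw [e1]
  have e4 : 1 - b' * d * (star b' * d) / (α * d) = α' / α := by
    rw [← e3]; field_simp
  rw [e4]
  by_cases h0 : α' = 0
  · simp [h0]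
  · field_simp
end
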